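/- For every integer ℓ ≥ 3 there exists a 1-apex simple graph G with exactly n = 11ℓ − 4 vertices such that cr_{1-apex}(G) ≥ ℓ and cr(G) ≤ 3 (hence the 1-apex crossing ratio is Ω(n)). -/

import Mathlib

open Set

noncomputable section

/-- A drawing of a simple graph in the plane: vertices are mapped to distinct
points, each edge `uv` is drawn as a simple arc joining the images of `u` and
`v` and avoiding the images of the other vertices, any two arcs meet in
finitely many points, and no three arcs pass through a common non-vertex
point. -/
structure Drawing {V : Type} (G : SimpleGraph V) where
  vpos : V → ℝ × ℝ
  vpos_inj : Function.Injective vpos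
  arc : V → V → ℝ → ℝ × ℝ
  arc_symm : ∀ u v t, arc u v t = arc v u (1 - t)
  arc_cont : ∀ u v, G.Adj u v → ContinuousOn (arc u v) (Set.Icc 0 1)
  arc_injOn : ∀ u v, G.Adj u v → Set.InjOn (arc u v) (Set.Icc 0 1)
  arc_start : ∀ u v, G.Adj u v → arc u v 0 = vpos u
  arc_end : ∀ u v, G.Adj u v → arc u v 1 = vpos v
  arc_avoids : ∀ u v, G.Adj u v → ∀ t ∈ Set.Ioo (0:ℝ) 1, arc u v t ∉ Set.range vpos
  inter_finite : ∀ u v w z, G.Adj u v → G.Adj w z → s(u, v) ≠ s(w, z) →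
    ((arc u v '' Set.Icc 0 1) ∩ (arc w z '' Set.Icc 0 1)).Finite
  no_triple_point : ∀ p : ℝ × ℝ, p ∉ Set.range vpos →
    ∀ u₁ v₁ u₂ v₂ u₃ v₃, G.Adj u₁ v₁ → G.Adj u₂ v₂ → G.Adj u₃ v₃ →
      s(u₁, v₁) ≠ s(u₂, v₂) → s(u₁, v₁) ≠ s(u₃, v₃) → s(u₂, v₂) ≠ s(u₃, v₃) →
      ¬ (p ∈ arc u₁ v₁ '' Set.Icc 0 1 ∧ p ∈ arc u₂ v₂ '' Set.Icc 0 1 ∧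
          p ∈ arc u₃ v₃ '' Set.Icc 0 1)

namespace Drawing

variable {V : Type} {G : SimpleGraph V}

lemma img_symm_aux (Γ : Drawing G) (u v : V) :
    Γ.arc u v '' Set.Icc 0 1 = Γ.arc v u '' Set.Icc 0 1 := by
  have key : ∀ a b : V, Γ.arc a b '' Set.Icc 0 1 ⊆ Γ.arc b a '' Set.Icc 0 1 := by
    rintro a b p ⟨t, ht, rfl⟩
    refine ⟨1 - t, ⟨by linarith [ht.2], by linarith [ht.1]⟩, ?_⟩
    rw [Γ.arc_symm b a (1 - t)]
    congr 1
    ring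
  exact Set.Subset.antisymm (key u v) (key v u)

/-- The image (trace) of an edge in the drawing. -/
def img (Γ : Drawing G) (e : Sym2 V) : Set (ℝ × ℝ) :=
  Sym2.lift ⟨fun u v => Γ.arc u v '' Set.Icc 0 1, fun u v => Γ.img_symm_aux u v⟩ e

/-- `p` is a crossing point of the two distinct edges `e` and `f` : it lies on
both arcs and is not the image of a vertex (so it is not a shared endpoint). -/
def Crossing (Γ : Drawing G) (e f : Sym2 V) (p : ℝ × ℝ) : Prop :=
  e ∈ G.edgeSet ∧ f ∈ G.edgeSet ∧ e ≠ f ∧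
    p ∈ Γ.img e ∧ p ∈ Γ.img f ∧ p ∉ Set.range Γ.vpos

/-- The edges `e` and `f` cross in the drawing. -/
def Crosses (Γ : Drawing G) (e f : Sym2 V) : Prop := ∃ p, Γ.Crossing e f p

/-- The set of crossing points of a drawing. -/
def crossingSet (Γ : Drawing G) : Set (ℝ × ℝ) := {p | ∃ e f, Γ.Crossing e f p}

/-- The number of crossings of a drawing. -/
def crossings (Γ : Drawing G) : ℕ := Γ.crossingSet.ncard

/-- The set of crossing points lying on a given edge. -/
def edgeCrossings (Γ : Drawing G) (e : Sym2 V) : Set (ℝ × ℝ) :=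
  {p | ∃ f, Γ.Crossing e f p}

/-- A drawing is `k`-planar if every edge is involved in at most `k` crossings. -/
def IsKPlanar (Γ : Drawing G) (k : ℕ) : Prop :=
  ∀ e ∈ G.edgeSet, (Γ.edgeCrossings e).ncard ≤ k

/-- A drawing is `k`-gap-planar if each crossing can be assigned to one of its
two involved edges such that every edge is assigned at most `k` crossings. -/
def IsKGapPlanar (Γ : Drawing G) (k : ℕ) : Prop :=
  ∃ assign : ℝ × ℝ → Sym2 V,
    (∀ p ∈ Γ.crossingSet, ∃ f, Γ.Crossing (assign p) f p) ∧
    ∀ e : Sym2 V, {p | p ∈ Γ.crossingSet ∧ assign p = e}.ncard ≤ k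

/-- A drawing is skewness-`k` if there is a set of at most `k` edges such that
every crossing involves an edge from the set. -/
def IsSkewness (Γ : Drawing G) (k : ℕ) : Prop :=
  ∃ S : Finset (Sym2 V), S.card ≤ k ∧
    ∀ p ∈ Γ.crossingSet, ∃ e ∈ S, ∃ f, Γ.Crossing e f p

/-- A drawing is `k`-apex if there is a set of at most `k` vertices such that
every crossing involves an edge incident to one of these vertices. -/
def IsKApex (Γ : Drawing G) (k : ℕ) : Prop :=
  ∃ S : Finset V, S.card ≤ k ∧
    ∀ p ∈ Γ.crossingSet, ∃ e f, Γ.Crossing e f p ∧ ∃ a ∈ S, a ∈ e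

/-- A drawing is `(k,l)`-grid-free if there is no set of `k` edges each of
which crosses each edge of some set of `l` edges. -/
def IsGridFree (Γ : Drawing G) (k l : ℕ) : Prop :=
  ¬ ∃ A B : Finset (Sym2 V), A.card = k ∧ B.card = l ∧
      ∀ e ∈ A, ∀ f ∈ B, Γ.Crosses e f

/-- A drawing is `k`-fan-crossing-free if no edge crosses `k` edges that all
share a common endpoint. -/
def IsKFanCrossingFree (Γ : Drawing G) (k : ℕ) : Prop :=
  ¬ ∃ (e : Sym2 V) (a : V) (F : Finset (Sym2 V)), F.card = k ∧
      ∀ f ∈ F, a ∈ f ∧ Γ.Crosses e f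

/-- A drawing is planarly connected if for any two crossing edges, two of
their endpoints are joined by a crossing-free edge. -/
def IsPlanarlyConnected (Γ : Drawing G) : Prop :=
  ∀ e f : Sym2 V, Γ.Crosses e f →
    ∃ a b : V, a ∈ e ∧ b ∈ f ∧ G.Adj a b ∧ Γ.edgeCrossings s(a, b) = ∅

/-- A drawing is straight-line if every edge is drawn as the line segment
between the images of its endpoints. -/
def IsStraight (Γ : Drawing G) : Prop :=
  ∀ u v : V, G.Adj u v → ∀ t ∈ Set.Icc (0:ℝ) 1,
    Γ.arc u v t = (1 - t) • Γ.vpos u + t • Γ.vpos v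

/-- A straight-line RAC drawing: straight-line and any two crossing edges are
perpendicular. -/
def IsRAC (Γ : Drawing G) : Prop :=
  Γ.IsStraight ∧
    ∀ u v w z : V, G.Adj u v → G.Adj w z → Γ.Crosses s(u, v) s(w, z) →
      (Γ.vpos v - Γ.vpos u).1 * (Γ.vpos z - Γ.vpos w).1 +
        (Γ.vpos v - Γ.vpos u).2 * (Γ.vpos z - Γ.vpos w).2 = 0

end Drawing

/-- The crossing number of `G`: the minimum number of crossings over all
drawings of `G`. -/
def crNum {V : Type} (G : SimpleGraph V) : ℕ :=
  sInf {n | ∃ Γ : Drawing G, Γ.crossings = n}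

/-- The crossing number of `G` restricted to drawings satisfying `P`. -/
def crNumRestricted {V : Type} (G : SimpleGraph V) (P : Drawing G → Prop) : ℕ :=
  sInf {n | ∃ Γ : Drawing G, P Γ ∧ Γ.crossings = n}

/-- The rectilinear crossing number of `G`. -/
def rectCrNum {V : Type} (G : SimpleGraph V) : ℕ :=
  crNumRestricted G (fun Γ => Γ.IsStraight)

/-- An ℓ₂-bundle between `x` and `y`: `P` is the set of the internal vertices
of ℓ internally disjoint paths of length two from `x` to `y`, all of whose
internal vertices have degree exactly two in `G` (here ℓ = `P.card`). -/
def IsL2Bundle {V : Type} (G : SimpleGraph V) (x y : V) (P : Finset V) : Prop :=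
  x ≠ y ∧ x ∉ P ∧ y ∉ P ∧
    ∀ p ∈ P, G.Adj x p ∧ G.Adj p y ∧ (G.neighborSet p).ncard = 2

/-- Two drawings of `G` are weakly isomorphic: there is an incidence-preserving
one-to-one correspondence of vertices and edges that preserves crossings. -/
def WeaklyIso {V : Type} {G : SimpleGraph V} (Γ Γ' : Drawing G) : Prop :=
  ∃ φ : G ≃g G, ∀ e f : Sym2 V,
    Γ.Crosses e f ↔ Γ'.Crosses (Sym2.map (fun a => φ a) e) (Sym2.map (fun a => φ a) f)

open scoped unitInterval

instance : ContractibleSpace I := (convex_Icc (0 : ℝ) 1).contractibleSpace ⟨0, by simp⟩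

instance : LocallyPathConnectedSpace I := (convex_Icc (0 : ℝ) 1).locallyPathConnectedSpace

lemma exists_continuous_log {A : Type*} [TopologicalSpace A] [SimplyConnectedSpace A]
    [LocallyPathConnectedSpace A] (F : C(A, ℂ)) (hF : ∀ x, F x ≠ 0) :
    ∃ L : C(A, ℂ), ∀ x, Complex.exp (L x) = F x := by
  obtain ⟨a⟩ : Nonempty A := inferInstance
  obtain ⟨L, hL, -⟩ := Complex.isCoveringMapOn_exp.existsUnique_continuousMap_lifts F
    (a₀ := a) (e₀ := Complex.log (F a)) (Complex.exp_log (hF a)) (by simpa using hF)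
  exact ⟨L, fun x => congrFun hL.2 x⟩

lemma log_increment_eq (l l' : C(I, ℂ)) (k : ℂ)
    (h : ∀ t, Complex.exp (l t) = k * Complex.exp (l' t)) : l 1 - l 0 = l' 1 - l' 0 := by
  have key : (fun t => l t - l 0 + l' 0) = l' := by
    refine Complex.isCoveringMap_exp.eq_of_comp_eq (by fun_prop) l'.continuous ?_ 0 (by simp)
    funext t
    have hk : k ≠ 0 := by
      rintro rfl
      simpa using h 0
    apply Subtype.ext
    simp only [Function.comp]
    rw [Complex.exp_add, Complex.exp_sub, h, h]
    field_simp [Complex.exp_ne_zero]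
  have := congrFun key 1
  rw [← this]
  ring

/-- `w` is the total change of a continuous logarithm of `p - v` along `p`. -/
def IsLogIncrement (p : C(I, ℂ)) (v w : ℂ) : Prop :=
  ∃ l : C(I, ℂ), (∀ t, Complex.exp (l t) = p t - v) ∧ w = l 1 - l 0

lemma exists_isLogIncrement (p : C(I, ℂ)) (v : ℂ) (h : ∀ t, p t ≠ v) :
    ∃ w, IsLogIncrement p v w := by
  obtain ⟨l, hl⟩ := exists_continuous_log (p - ContinuousMap.const I v)
    (fun t => by simpa [sub_eq_zero] using h t)
  exact ⟨_, l, fun t => by simpa using hl t, rfl⟩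

lemma IsLogIncrement.eq_add_int {p : C(I, ℂ)} {v w : ℂ} (h : IsLogIncrement p v w) :
    ∃ n : ℤ, w = Complex.log (p 1 - v) - Complex.log (p 0 - v) + n * (2 * Real.pi * Complex.I) := by
  obtain ⟨l, hl, rfl⟩ := h
  apply Complex.exp_eq_exp_iff_exists_int.mp
  have h0 : ∀ t, p t - v ≠ 0 := fun t => hl t ▸ Complex.exp_ne_zero _
  rw [Complex.exp_sub, Complex.exp_sub, hl, hl, Complex.exp_log (h0 1), Complex.exp_log (h0 0)]

lemma exists_log_sub_comm {u v : ℂ} (h : u ≠ v) :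
    ∃ k : ℤ, Complex.log (v - u) = Complex.log (u - v) + (2 * k + 1) * (Real.pi * Complex.I) := by
  have h1 : v - u ≠ 0 := sub_ne_zero.mpr h.symm
  have h2 : u - v ≠ 0 := sub_ne_zero.mpr h
  have : Complex.exp (Complex.log (v - u)) =
      Complex.exp (Complex.log (u - v) + Real.pi * Complex.I) := by
    rw [Complex.exp_add, Complex.exp_log h1, Complex.exp_log h2, Complex.exp_pi_mul_I]
    ring
  obtain ⟨k, hk⟩ := Complex.exp_eq_exp_iff_exists_int.mp this
  exact ⟨k, by rw [hk]; ring⟩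

lemma IsLogIncrement.boundary_square {p q : C(I, ℂ)} (hpq : ∀ s t, p s ≠ q t) {w₁ w₂ w₃ w₄ : ℂ}
    (h₁ : IsLogIncrement p (q 0) w₁) (h₂ : IsLogIncrement p (q 1) w₂)
    (h₃ : IsLogIncrement q (p 0) w₃) (h₄ : IsLogIncrement q (p 1) w₄) :
    w₁ + w₄ = w₂ + w₃ := by
  obtain ⟨L, hL⟩ := exists_continuous_log
    (⟨fun x => p x.1 - q x.2, by fun_prop⟩ : C(I × I, ℂ)) (fun x => sub_ne_zero.mpr (hpq _ _))
  simp only [ContinuousMap.coe_mk] at hL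
  obtain ⟨l₁, e₁, rfl⟩ := h₁
  obtain ⟨l₂, e₂, rfl⟩ := h₂
  obtain ⟨l₃, e₃, rfl⟩ := h₃
  obtain ⟨l₄, e₄, rfl⟩ := h₄
  have r₁ := log_increment_eq l₁ ⟨fun s => L (s, 0), by fun_prop⟩ 1 (fun t => by simp [hL, e₁])
  have r₂ := log_increment_eq l₂ ⟨fun s => L (s, 1), by fun_prop⟩ 1 (fun t => by simp [hL, e₂])
  have r₃ := log_increment_eq l₃ ⟨fun t => L (0, t), by fun_prop⟩ (-1) (fun t => by simp [hL, e₃])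
  have r₄ := log_increment_eq l₄ ⟨fun t => L (1, t), by fun_prop⟩ (-1) (fun t => by simp [hL, e₄])
  simp only [ContinuousMap.coe_mk] at r₁ r₂ r₃ r₄
  rw [r₁, r₂, r₃, r₄]
  ring

/-- The complete bipartite graph `K₃,₃` is not planar: among nine paths joining three points to
three points, two paths without a common end must meet. -/
theorem exists_meeting_paths (A B : Fin 3 → ℂ) (γ : Fin 3 → Fin 3 → C(I, ℂ))
    (h0 : ∀ i j, γ i j 0 = A i) (h1 : ∀ i j, γ i j 1 = B j) :
    ∃ i i' j j' s t, i ≠ i' ∧ j ≠ j' ∧ γ i j s = γ i' j' t := by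
  by_contra! hdis
  have hex : ∀ j : Fin 3, ∃ j', j ≠ j' := by decide
  have hU : ∀ i j i', ∃ n : ℤ, i ≠ i' → IsLogIncrement (γ i j) (A i')
      (Complex.log (B j - A i') - Complex.log (A i - A i') + n * (2 * Real.pi * Complex.I)) := by
    intro i j i'
    by_cases hi : i = i'
    · exact ⟨0, fun h => (h hi).elim⟩
    obtain ⟨j', hj⟩ := hex j
    obtain ⟨w, hw⟩ := exists_isLogIncrement (γ i j) (A i')
      (fun t => by rw [← h0 i' j']; exact hdis i i' j j' t 0 hi hj)
    obtain ⟨n, rfl⟩ := hw.eq_add_int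
    exact ⟨n, fun _ => by simpa only [h0, h1] using hw⟩
  have hX : ∀ i j j', ∃ n : ℤ, j ≠ j' → IsLogIncrement (γ i j) (B j')
      (Complex.log (B j - B j') - Complex.log (A i - B j') + n * (2 * Real.pi * Complex.I)) := by
    intro i j j'
    by_cases hj : j = j'
    · exact ⟨0, fun h => (h hj).elim⟩
    obtain ⟨i', hi⟩ := hex i
    obtain ⟨w, hw⟩ := exists_isLogIncrement (γ i j) (B j')
      (fun t => by rw [← h1 i' j']; exact hdis i i' j j' t 1 hi hj)
    obtain ⟨n, rfl⟩ := hw.eq_add_int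
    exact ⟨n, fun _ => by simpa only [h0, h1] using hw⟩
  choose n hn using hU
  choose m hm using hX
  have hAB : ∀ i j, A i ≠ B j := by
    intro i j
    obtain ⟨i', hi⟩ := hex i
    obtain ⟨j', hj⟩ := hex j
    rw [← h0 i j', ← h1 i' j]
    exact hdis _ _ _ _ _ _ hi hj.symm
  have hAA : ∀ i i', ∃ k : ℤ, i ≠ i' → Complex.log (A i' - A i) =
      Complex.log (A i - A i') + (2 * k + 1) * (Real.pi * Complex.I) := by
    intro i i'
    by_cases hi : i = i'
    · exact ⟨0, fun h => (h hi).elim⟩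
    have : A i ≠ A i' := by
      rw [← h0 i 0, ← h0 i' 1]
      exact hdis _ _ _ _ _ _ hi (by decide)
    exact (exists_log_sub_comm this).imp fun _ h _ => h
  choose a ha using fun i j => exists_log_sub_comm (hAB i j)
  have hBB : ∀ j j', ∃ k : ℤ, j ≠ j' → Complex.log (B j' - B j) =
      Complex.log (B j - B j') + (2 * k + 1) * (Real.pi * Complex.I) := by
    intro j j'
    by_cases hj : j = j'
    · exact ⟨0, fun h => (h hj).elim⟩
    have : B j ≠ B j' := by
      rw [← h1 0 j, ← h1 1 j']
      exact hdis _ _ _ _ _ _ (by decide) hj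
    exact (exists_log_sub_comm this).imp fun _ h _ => h
  choose c hc using hAA
  choose d hd using hBB
  have hpi : (Real.pi * Complex.I : ℂ) ≠ 0 := by simp [Real.pi_ne_zero]
  have d_anti : ∀ j j', j ≠ j' → d j j' + d j' j + 1 = 0 := by
    intro j j' hj
    have h : (2 * ((d j j' + d j' j + 1 : ℤ) : ℂ)) * (Real.pi * Complex.I) = 0 := by
      push_cast
      linear_combination -hd j j' hj - hd j' j hj.symm
    simpa only [mul_eq_zero, hpi, or_false, two_ne_zero, false_or, Int.cast_eq_zero] using h
  have rel : ∀ i i' j j', i ≠ i' → j ≠ j' →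
      a i' j + c i i' + n i j i' - a i j' + d j j' + 1 + m i' j' j - m i j j' - n i' j' i = 0 := by
    intro i i' j j' hi hj
    have key := IsLogIncrement.boundary_square (p := γ i j) (q := γ i' j')
      (fun s t => hdis i i' j j' s t hi hj) (by rw [h0]; exact hn i j i' hi)
      (by rw [h1]; exact hm i j j' hj) (by rw [h0]; exact hn i' j' i hi.symm)
      (by rw [h1]; exact hm i' j' j hj.symm)
    have h : (2 * ((a i' j + c i i' + n i j i' - a i j' + d j j' + 1 + m i' j' j - m i j j' -
        n i' j' i : ℤ) : ℂ)) * (Real.pi * Complex.I) = 0 := by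
      push_cast
      linear_combination key - ha i' j - hc i i' hi + ha i j' - hd j j' hj
    simpa only [mul_eq_zero, hpi, or_false, two_ne_zero, false_or, Int.cast_eq_zero] using h
  have sum := fun i i' (hi : i ≠ i') =>
    show 2 * ((a i' 0 + a i' 1 + a i' 2) - (a i 0 + a i 1 + a i 2)) + 6 * c i i' +
        2 * ((n i 0 i' + n i 1 i' + n i 2 i') - (n i' 0 i + n i' 1 i + n i' 2 i)) +
        (m i' 0 1 + m i' 0 2 + m i' 1 0 + m i' 1 2 + m i' 2 0 + m i' 2 1) -
        (m i 0 1 + m i 0 2 + m i 1 0 + m i 1 2 + m i 2 0 + m i 2 1) + 3 = 0 by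
      linear_combination rel i i' 0 1 hi (by decide) + rel i i' 0 2 hi (by decide) +
        rel i i' 1 0 hi (by decide) + rel i i' 1 2 hi (by decide) +
        rel i i' 2 0 hi (by decide) + rel i i' 2 1 hi (by decide) -
        d_anti 0 1 (by decide) - d_anti 0 2 (by decide) - d_anti 1 2 (by decide)
  have := sum 0 1 (by decide)
  have := sum 0 2 (by decide)
  have := sum 1 2 (by decide)
  omega

/-- The vertices of the graph: an apex, isolated vertices, and two copies of the rest of a `K₃,₃`
in which every edge at the apex is replaced by `ℓ` paths of length two. -/
inductive Vtx (ℓ m : ℕ)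
  | apex
  | iso (k : Fin m)
  | mid (c : Bool) (j : Fin 3) (i : Fin ℓ)
  | port (c : Bool) (j : Fin 3)
  | hub (c : Bool) (k : Bool)

namespace Vtx

variable {ℓ m : ℕ}

/-- The copy a vertex belongs to, if any. -/
def copy : Vtx ℓ m → Option Bool
  | apex => none
  | iso _ => none
  | mid c _ _ => some c
  | port c _ => some c
  | hub c _ => some c

/-- The edges, oriented. -/
inductive Arrow : Vtx ℓ m → Vtx ℓ m → Prop
  | apexMid (c j i) : Arrow apex (mid c j i)
  | midPort (c j i) : Arrow (mid c j i) (port c j)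
  | portHub (c j k) : Arrow (port c j) (hub c k)

/-- The graph of the theorem. -/
def graph (ℓ m : ℕ) : SimpleGraph (Vtx ℓ m) := SimpleGraph.fromRel Arrow

lemma graph_adj {u v : Vtx ℓ m} : (graph ℓ m).Adj u v ↔ Arrow u v ∨ Arrow v u := by
  simp only [graph, SimpleGraph.fromRel_adj, and_iff_right_iff_imp]
  rintro (h | h) rfl <;> cases h

/-- Splitting of the vertices by kind. -/
def equivSum (ℓ m : ℕ) : Vtx ℓ m ≃
    (Unit ⊕ Fin m) ⊕ (Bool × Fin 3 × Fin ℓ) ⊕ (Bool × Fin 3) ⊕ (Bool × Bool) where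
  toFun
    | apex => .inl (.inl ())
    | iso k => .inl (.inr k)
    | mid c j i => .inr (.inl (c, j, i))
    | port c j => .inr (.inr (.inl (c, j)))
    | hub c k => .inr (.inr (.inr (c, k)))
  invFun
    | .inl (.inl _) => apex
    | .inl (.inr k) => iso k
    | .inr (.inl (c, j, i)) => mid c j i
    | .inr (.inr (.inl (c, j))) => port c j
    | .inr (.inr (.inr (c, k))) => hub c k
  left_inv := by rintro (_ | _ | _ | _ | _) <;> rfl
  right_inv := by rintro ((_ | _) | _ | _ | _) <;> rfl

lemma nonempty_equiv_fin (ℓ m : ℕ) : Nonempty (Fin (6 * ℓ + 11 + m) ≃ Vtx ℓ m) := by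
  refine ⟨(((equivSum ℓ m).trans (Fintype.equivFinOfCardEq ?_))).symm⟩
  simp
  ring

/-- `OnPath c i a j u v` says that `uv` is an edge of the path from the `a`-th to the `j`-th
vertex of the `i`-th subdivided `K₃,₃` in copy `c`. -/
inductive OnPath (c : Bool) (i : Fin ℓ) : Fin 3 → Fin 3 → Vtx ℓ m → Vtx ℓ m → Prop
  | apexMid (j) : OnPath c i 0 j apex (mid c j i)
  | midPort (j) : OnPath c i 0 j (mid c j i) (port c j)
  | hubTrue (j) : OnPath c i 1 j (port c j) (hub c true)
  | hubFalse (j) : OnPath c i 2 j (port c j) (hub c false)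

namespace OnPath

variable {c : Bool} {i : Fin ℓ} {a a' j j' : Fin 3} {u v u' v' : Vtx ℓ m}

lemma arrow (h : OnPath c i a j u v) : Arrow u v := by
  cases h <;> constructor

lemma eq_apexMid (h : OnPath c i a j u v) (hx : u = apex ∨ v = apex) :
    a = 0 ∧ u = apex ∧ v = mid c j i := by
  cases h <;> simp_all

lemma copy_left (h : OnPath c i a j u v) : u = apex ∨ u.copy = some c := by
  cases h <;> simp [copy]

lemma copy_right (h : OnPath c i a j u v) : v.copy = some c := by
  cases h <;> simp [copy]

lemma disjoint (h : OnPath c i a j u v) (h' : OnPath c i a' j' u' v') (ha : a ≠ a') (hj : j ≠ j')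
    {x : Vtx ℓ m} (hx : x = u ∨ x = v) (hx' : x = u' ∨ x = v') : False := by
  cases h <;> cases h' <;> aesop

end OnPath

end Vtx

namespace Drawing

variable {V : Type} {G : SimpleGraph V}

/-- An edge of a drawing, as a path in the complex plane. -/
def edgePath (Γ : Drawing G) {u v : V} (h : G.Adj u v) :
    Path (Complex.equivRealProdCLM.symm (Γ.vpos u)) (Complex.equivRealProdCLM.symm (Γ.vpos v)) where
  toFun t := Complex.equivRealProdCLM.symm (Γ.arc u v t)
  continuous_toFun := Complex.equivRealProdCLM.symm.continuous.comp
    (continuousOn_iff_continuous_domRestrict.mp (Γ.arc_cont u v h))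
  source' := by simp [Γ.arc_start u v h]
  target' := by simp [Γ.arc_end u v h]

lemma mem_img_of_mem_range_edgePath (Γ : Drawing G) {u v : V} (h : G.Adj u v) {x : ℂ}
    (hx : x ∈ Set.range (Γ.edgePath h)) : Complex.equivRealProdCLM x ∈ Γ.img s(u, v) := by
  obtain ⟨t, rfl⟩ := hx
  exact ⟨t, t.2, by simp [edgePath]⟩

lemma mem_of_vpos_mem_img (Γ : Drawing G) {u v w : V} (h : G.Adj u v)
    (hw : Γ.vpos w ∈ Γ.img s(u, v)) : w = u ∨ w = v := by
  obtain ⟨t, ht, htw⟩ := hw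
  rcases ht.1.eq_or_lt with rfl | h0
  · rw [Γ.arc_start u v h] at htw
    exact .inl (Γ.vpos_inj htw.symm)
  rcases ht.2.eq_or_lt with rfl | h1
  · rw [Γ.arc_end u v h] at htw
    exact .inr (Γ.vpos_inj htw.symm)
  · exact (Γ.arc_avoids u v h t ⟨h0, h1⟩ ⟨w, htw.symm⟩).elim

lemma Crossing.symm {Γ : Drawing G} {e f : Sym2 V} {p : ℝ × ℝ} (h : Γ.Crossing e f p) :
    Γ.Crossing f e p :=
  ⟨h.2.1, h.1, h.2.2.1.symm, h.2.2.2.2.1, h.2.2.2.1, h.2.2.2.2.2⟩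

lemma Crossing.eq_or_eq {Γ : Drawing G} {e f e' f' : Sym2 V} {p : ℝ × ℝ} (h : Γ.Crossing e f p)
    (h' : Γ.Crossing e' f' p) : e' = e ∨ e' = f := by
  obtain ⟨he, hf, hne, hpe, hpf, hp⟩ := h
  obtain ⟨he', -, -, hpe', -⟩ := h'
  by_contra! hc
  induction e with | h a b => ?_
  induction f with | h a₁ b₁ => ?_
  induction e' with | h a₂ b₂ => ?_
  exact Γ.no_triple_point p hp a b a₁ b₁ a₂ b₂ he hf he' hne hc.1.symm hc.2.symm
    ⟨hpe, hpf, hpe'⟩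

lemma finite_crossingSet [Finite V] (Γ : Drawing G) : Γ.crossingSet.Finite := by
  have : Γ.crossingSet ⊆ ⋃ (e : Sym2 V) (f : Sym2 V), {p | Γ.Crossing e f p} := by
    rintro p ⟨e, f, h⟩
    exact Set.mem_iUnion₂.mpr ⟨e, f, h⟩
  refine (Set.finite_iUnion fun e => Set.finite_iUnion fun f => ?_).subset this
  by_cases h : e ∈ G.edgeSet ∧ f ∈ G.edgeSet ∧ e ≠ f
  · induction e with | h a b => ?_
    induction f with | h a₁ b₁ => ?_
    exact (Γ.inter_finite a b a₁ b₁ h.1 h.2.1 h.2.2).subset fun p hp => ⟨hp.2.2.2.1, hp.2.2.2.2.1⟩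
  · exact Set.finite_empty.subset fun p hp => h ⟨hp.1, hp.2.1, hp.2.2.1⟩

open Vtx

variable {ℓ m : ℕ}

lemma exists_crossing_onPath (Γ : Drawing G) {f : Vtx ℓ m → V} (hf : Function.Injective f)
    (hadj : ∀ u v, Arrow u v → G.Adj (f u) (f v)) (c : Bool) (i : Fin ℓ) :
    ∃ a a' j j' u v u' v' p, a ≠ a' ∧ j ≠ j' ∧ OnPath c i a j u v ∧ OnPath c i a' j' u' v' ∧
      Γ.Crossing s(f u, f v) s(f u', f v') p := by
  let z : ℝ × ℝ → ℂ := Complex.equivRealProdCLM.symm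
  let A : Fin 3 → Vtx ℓ m := ![apex, hub c true, hub c false]
  have hpath : ∀ a j, ∃ γ : Path (z (Γ.vpos (f (A a)))) (z (Γ.vpos (f (port c j)))),
      ∀ t, ∃ u v, OnPath c i a j u v ∧ Complex.equivRealProdCLM (γ t) ∈ Γ.img s(f u, f v) := by
    intro a j
    have hhub : ∀ k, OnPath c i a j (port c j) (hub c k) →
        ∃ γ : Path (z (Γ.vpos (f (hub c k)))) (z (Γ.vpos (f (port c j)))),
        ∀ t, ∃ u v, OnPath c i a j u v ∧ Complex.equivRealProdCLM (γ t) ∈ Γ.img s(f u, f v) :=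
      fun k h => ⟨Γ.edgePath (hadj _ _ h.arrow).symm, fun t => ⟨_, _, h, by
        rw [Sym2.eq_swap]
        exact Γ.mem_img_of_mem_range_edgePath _ ⟨t, rfl⟩⟩⟩
    fin_cases a
    · have h₁ := OnPath.apexMid (m := m) (c := c) (i := i) j
      have h₂ := OnPath.midPort (m := m) (c := c) (i := i) j
      refine ⟨(Γ.edgePath (hadj _ _ h₁.arrow)).trans (Γ.edgePath (hadj _ _ h₂.arrow)),
        fun t => ?_⟩
      have ht := Set.mem_range_self (f := (Γ.edgePath (hadj _ _ h₁.arrow)).trans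
        (Γ.edgePath (hadj _ _ h₂.arrow))) t
      rw [Path.trans_range] at ht
      rcases ht with ht | ht
      · exact ⟨_, _, h₁, Γ.mem_img_of_mem_range_edgePath _ ht⟩
      · exact ⟨_, _, h₂, Γ.mem_img_of_mem_range_edgePath _ ht⟩
    · exact hhub true (.hubTrue j)
    · exact hhub false (.hubFalse j)
  choose γ hγ using hpath
  obtain ⟨a, a', j, j', s, t, ha, hj, hst⟩ := exists_meeting_paths
    (fun a => z (Γ.vpos (f (A a)))) (fun j => z (Γ.vpos (f (port c j))))
    (fun a j => (γ a j : C(I, ℂ))) (fun a j => (γ a j).source) (fun a j => (γ a j).target)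
  obtain ⟨u, v, h, hp⟩ := hγ a j s
  obtain ⟨u', v', h', hp'⟩ := hγ a' j' t
  have hst' : γ a j s = γ a' j' t := hst
  rw [← hst'] at hp'
  have hdis : ∀ w, Γ.vpos w = Complex.equivRealProdCLM (γ a j s) → False := by
    intro w hw
    rw [← hw] at hp hp'
    have h₁ := Γ.mem_of_vpos_mem_img (hadj _ _ h.arrow) hp
    have h₂ := Γ.mem_of_vpos_mem_img (hadj _ _ h'.arrow) hp'
    rcases h₁ with rfl | rfl
    · exact h.disjoint h' ha hj (.inl rfl) (by simpa only [hf.eq_iff] using h₂)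
    · exact h.disjoint h' ha hj (.inr rfl) (by simpa only [hf.eq_iff] using h₂)
  refine ⟨a, a', j, j', u, v, u', v', _, ha, hj, h, h', hadj _ _ h.arrow, hadj _ _ h'.arrow,
    fun he => ?_, hp, hp', fun ⟨w, hw⟩ => hdis w hw⟩
  have : f u ∈ s(f u', f v') := he ▸ Sym2.mem_mk_left _ _
  rw [Sym2.mem_iff] at this
  exact h.disjoint h' ha hj (.inl rfl) (by simpa only [hf.eq_iff] using this)

theorem le_crossings_of_isKApex_one [Finite V] (Γ : Drawing G) {f : Vtx ℓ m → V}
    (hf : Function.Injective f) (hadj : ∀ u v, Arrow u v → G.Adj (f u) (f v))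
    (hΓ : Γ.IsKApex 1) : ℓ ≤ Γ.crossings := by
  obtain ⟨S, hS, hcross⟩ := hΓ
  rcases Nat.eq_zero_or_pos ℓ with rfl | hℓ
  · exact Nat.zero_le _
  by_cases hx : f apex ∈ S
  · have key : ∀ i, ∃ p j g, Γ.Crossing s(f apex, f (mid true j i)) g p ∧ f apex ∉ g := by
      intro i
      obtain ⟨a, a', j, j', u, v, u', v', p, ha, hj, h, h', hc⟩ :=
        Γ.exists_crossing_onPath hf hadj true i
      obtain ⟨e, g, he, x, hxS, hxe⟩ := hcross p ⟨_, _, hc⟩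
      obtain rfl := Finset.card_le_one.mp hS x hxS _ hx
      rcases hc.eq_or_eq he with rfl | rfl
      · simp only [Sym2.mem_iff, hf.eq_iff, eq_comm (a := apex)] at hxe
        obtain ⟨rfl, rfl, rfl⟩ := h.eq_apexMid hxe
        refine ⟨p, j, _, hc, fun hg => ?_⟩
        simp only [Sym2.mem_iff, hf.eq_iff, eq_comm (a := apex)] at hg
        exact ha (h'.eq_apexMid hg).1.symm
      · simp only [Sym2.mem_iff, hf.eq_iff, eq_comm (a := apex)] at hxe
        obtain ⟨rfl, rfl, rfl⟩ := h'.eq_apexMid hxe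
        refine ⟨p, j', _, hc.symm, fun hg => ?_⟩
        simp only [Sym2.mem_iff, hf.eq_iff, eq_comm (a := apex)] at hg
        exact ha (h.eq_apexMid hg).1
    choose p j g hg hag using key
    have hinj : Function.Injective p := by
      intro i k hik
      by_contra hne
      have hne' : s(f apex, f (mid true (j i) i)) ≠ s(f apex, f (mid true (j k) k)) := by
        simp [hf.eq_iff, hne]
      have hik' : Γ.Crossing s(f apex, f (mid true (j i) i)) s(f apex, f (mid true (j k) k)) (p i) :=
        ⟨(hg i).1, (hg k).1, hne', (hg i).2.2.2.1, hik ▸ (hg k).2.2.2.1, (hg i).2.2.2.2.2⟩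
      rcases hik'.eq_or_eq (hg i).symm with h | h <;> exact hag i (h ▸ Sym2.mem_mk_left _ _)
    calc ℓ = (Set.range p).ncard := by
          rw [← Set.image_univ, Set.ncard_image_of_injective _ hinj, Set.ncard_univ, Nat.card_fin]
      _ ≤ Γ.crossings := Set.ncard_le_ncard
          (by rintro _ ⟨i, rfl⟩; exact ⟨_, _, hg i⟩) Γ.finite_crossingSet
  · have key : ∀ c, ∃ x : Vtx ℓ m, f x ∈ S ∧ x.copy = some c := by
      intro c
      obtain ⟨a, a', j, j', u, v, u', v', p, ha, hj, h, h', hc⟩ :=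
        Γ.exists_crossing_onPath hf hadj c ⟨0, hℓ⟩
      obtain ⟨e, g, he, x, hxS, hxe⟩ := hcross p ⟨_, _, hc⟩
      have hcopy : ∀ {a j u v}, OnPath c ⟨0, hℓ⟩ a j u v → x ∈ s(f u, f v) →
          ∃ x : Vtx ℓ m, f x ∈ S ∧ x.copy = some c := by
        intro a j u v h hxe
        rcases Sym2.mem_iff.mp hxe with rfl | rfl
        · exact ⟨u, hxS, h.copy_left.resolve_left (by rintro rfl; exact hx hxS)⟩
        · exact ⟨v, hxS, h.copy_right⟩
      rcases hc.eq_or_eq he with rfl | rfl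
      · exact hcopy h hxe
      · exact hcopy h' hxe
    obtain ⟨x, hxS, hxc⟩ := key true
    obtain ⟨y, hyS, hyc⟩ := key false
    obtain rfl := hf (Finset.card_le_one.mp hS _ hxS _ hyS)
    simp [hxc] at hyc

end Drawing

lemma exists_lineMap_of_mem_segment {a b p q : ℝ × ℝ} (hp : p ∈ segment ℝ a b)
    (hq : q ∈ segment ℝ a b) (hpq : p ≠ q) :
    ∃ α β : ℝ, a = AffineMap.lineMap p q α ∧ b = AffineMap.lineMap p q β ∧
      (α ≤ 0 ∧ 1 ≤ β ∨ β ≤ 0 ∧ 1 ≤ α) := by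
  rw [segment_eq_image_lineMap] at hp hq
  obtain ⟨s, hs, rfl⟩ := hp
  obtain ⟨t, ht, rfl⟩ := hq
  have hst : t - s ≠ 0 := sub_ne_zero.mpr (by rintro rfl; exact hpq rfl)
  refine ⟨-s / (t - s), (1 - s) / (t - s), ?_, ?_, ?_⟩
  · ext <;> simp [AffineMap.lineMap_apply] <;> field_simp <;> ring
  · ext <;> simp [AffineMap.lineMap_apply] <;> field_simp <;> ring
  · rcases lt_or_gt_of_ne hst with h | h
    · right
      rw [le_div_iff_of_neg h, div_le_iff_of_neg h]
      constructor <;> linarith [hs.1, hs.2, ht.1, ht.2]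
    · left
      rw [div_le_iff₀ h, le_div_iff₀ h]
      constructor <;> linarith [hs.1, hs.2, ht.1, ht.2]

lemma lineMap_mem_segment_lineMap {p q : ℝ × ℝ} {α β γ : ℝ} (h : α ≤ γ ∧ γ ≤ β ∨ β ≤ γ ∧ γ ≤ α) :
    (AffineMap.lineMap p q γ : ℝ × ℝ) ∈
      segment ℝ (AffineMap.lineMap p q α : ℝ × ℝ) (AffineMap.lineMap p q β) := by
  rw [← image_segment, segment_eq_uIcc]
  exact Set.mem_image_of_mem _ (Set.mem_uIcc.mpr h)

/-- If no end of one of two segments lies inside or on the other one except as a common end, then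
the segments coincide or meet in at most one point. -/
lemma segment_inter_subsingleton {a b c d : ℝ × ℝ}
    (hc : c ∈ segment ℝ a b → c = a ∨ c = b) (hd : d ∈ segment ℝ a b → d = a ∨ d = b)
    (ha : a ∈ segment ℝ c d → a = c ∨ a = d) (hb : b ∈ segment ℝ c d → b = c ∨ b = d)
    (hne : s(a, b) ≠ s(c, d)) : (segment ℝ a b ∩ segment ℝ c d).Subsingleton := by
  intro p hp q hq
  by_contra hpq
  obtain ⟨α, β, rfl, rfl, h₁⟩ := exists_lineMap_of_mem_segment hp.1 hq.1 hpq
  obtain ⟨γ, δ, rfl, rfl, h₂⟩ := exists_lineMap_of_mem_segment hp.2 hq.2 hpq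
  have inj : ∀ x y : ℝ, (AffineMap.lineMap p q x : ℝ × ℝ) = AffineMap.lineMap p q y ↔ x = y :=
    fun x y => (AffineMap.lineMap_injective ℝ hpq).eq_iff
  replace hc := fun h => hc (lineMap_mem_segment_lineMap h)
  replace hd := fun h => hd (lineMap_mem_segment_lineMap h)
  replace ha := fun h => ha (lineMap_mem_segment_lineMap h)
  replace hb := fun h => hb (lineMap_mem_segment_lineMap h)
  simp only [ne_eq, Sym2.eq_iff, inj] at hne ha hb hc hd
  grind

/-- `pos` gives a straight-line drawing of `G`, and of any two crossing edges exactly one is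
incident to `T`. -/
structure IsStraightLayout {V : Type} (G : SimpleGraph V) (pos : V → ℝ × ℝ) (T : Set V) :
    Prop where
  inj : Function.Injective pos
  avoids : ∀ u v w, G.Adj u v → pos w ∈ segment ℝ (pos u) (pos v) → w = u ∨ w = v
  bipartite : ∀ u v w z p, G.Adj u v → G.Adj w z → s(u, v) ≠ s(w, z) →
    p ∈ segment ℝ (pos u) (pos v) → p ∈ segment ℝ (pos w) (pos z) → p ∉ Set.range pos →
    ((u ∈ T ∨ v ∈ T) ↔ ¬ (w ∈ T ∨ z ∈ T))

namespace IsStraightLayout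

variable {V W : Type} {G : SimpleGraph V} {pos : V → ℝ × ℝ} {T : Set V}

lemma comap (h : IsStraightLayout G pos T) (e : W ≃ V) :
    IsStraightLayout (G.comap e) (pos ∘ e) (e ⁻¹' T) where
  inj := h.inj.comp e.injective
  avoids u v w huv hw := by simpa using h.avoids (e u) (e v) (e w) huv hw
  bipartite u v w z p huv hwz hne hp hp' hr := by
    refine h.bipartite (e u) (e v) (e w) (e z) p huv hwz ?_ hp hp' ?_
    · simpa [Sym2.eq_iff] using hne
    · rwa [e.surjective.range_comp] at hr

/-- The straight-line drawing given by a layout. -/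
def drawing (h : IsStraightLayout G pos T) : Drawing G where
  vpos := pos
  vpos_inj := h.inj
  arc u v t := AffineMap.lineMap (pos u) (pos v) t
  arc_symm u v t := (AffineMap.lineMap_apply_one_sub _ _ _).symm
  arc_cont u v _ := AffineMap.lineMap_continuous.continuousOn
  arc_injOn u v huv := (AffineMap.lineMap_injective ℝ (h.inj.ne huv.ne)).injOn
  arc_start u v _ := AffineMap.lineMap_apply_zero _ _
  arc_end u v _ := AffineMap.lineMap_apply_one _ _
  arc_avoids u v huv t ht := by
    rintro ⟨w, hw⟩
    have hinj := AffineMap.lineMap_injective ℝ (h.inj.ne huv.ne)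
    have hmem : pos w ∈ segment ℝ (pos u) (pos v) := by
      rw [segment_eq_image_lineMap]
      exact ⟨t, Set.Ioo_subset_Icc_self ht, hw.symm⟩
    rcases h.avoids u v w huv hmem with rfl | rfl
    · exact ht.1.ne (hinj ((AffineMap.lineMap_apply_zero _ _).trans hw))
    · exact ht.2.ne (hinj ((AffineMap.lineMap_apply_one _ _).trans hw)).symm
  inter_finite u v w z huv hwz hne := by
    simp only [← segment_eq_image_lineMap]
    apply Set.Subsingleton.finite
    apply segment_inter_subsingleton
    · exact fun hm => (h.avoids u v w huv hm).imp (congrArg pos) (congrArg pos)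
    · exact fun hm => (h.avoids u v z huv hm).imp (congrArg pos) (congrArg pos)
    · exact fun hm => (h.avoids w z u hwz hm).imp (congrArg pos) (congrArg pos)
    · exact fun hm => (h.avoids w z v hwz hm).imp (congrArg pos) (congrArg pos)
    · simpa [Sym2.eq_iff, h.inj.eq_iff] using hne
  no_triple_point p hp u₁ v₁ u₂ v₂ u₃ v₃ h₁ h₂ h₃ h₁₂ h₁₃ h₂₃ := by
    simp only [← segment_eq_image_lineMap]
    rintro ⟨m₁, m₂, m₃⟩
    have b₁₂ := h.bipartite _ _ _ _ p h₁ h₂ h₁₂ m₁ m₂ hp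
    have b₁₃ := h.bipartite _ _ _ _ p h₁ h₃ h₁₃ m₁ m₃ hp
    have b₂₃ := h.bipartite _ _ _ _ p h₂ h₃ h₂₃ m₂ m₃ hp
    tauto

lemma exists_of_crossing (h : IsStraightLayout G pos T) {e f : Sym2 V} {p : ℝ × ℝ}
    (hc : h.drawing.Crossing e f p) : ∃ u v w z, e = s(u, v) ∧ f = s(w, z) ∧ G.Adj u v ∧
      G.Adj w z ∧ s(u, v) ≠ s(w, z) ∧ p ∈ segment ℝ (pos u) (pos v) ∧
      p ∈ segment ℝ (pos w) (pos z) ∧ p ∉ Set.range pos := by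
  obtain ⟨he, hf, hne, hpe, hpf, hp⟩ := hc
  induction e with | h u v => ?_
  induction f with | h w z => ?_
  simp only [segment_eq_image_lineMap]
  exact ⟨u, v, w, z, rfl, rfl, he, hf, hne, hpe, hpf, hp⟩

lemma isKApex_one {a : V} (h : IsStraightLayout G pos {a}) : h.drawing.IsKApex 1 := by
  refine ⟨{a}, by simp, fun p ⟨e, f, hc⟩ => ?_⟩
  obtain ⟨u, v, w, z, rfl, rfl, huv, hwz, hne, hp, hp', hr⟩ := h.exists_of_crossing hc
  have := h.bipartite u v w z p huv hwz hne hp hp' hr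
  by_cases hw : w ∈ ({a} : Set V) ∨ z ∈ ({a} : Set V)
  · exact ⟨_, _, hc.symm, a, by simp, by simpa [eq_comm] using hw⟩
  · exact ⟨_, _, hc, a, by simp, by simpa [eq_comm] using this.mpr hw⟩

end IsStraightLayout

namespace Vtx

variable {ℓ m : ℕ}

/-- The side of the second coordinate axis on which a copy is drawn. -/
def side (c : Bool) : ℝ := if c then 1 else -1

lemma side_mul_self (c : Bool) : side c * side c = 1 := by
  cases c <;> norm_num [side]

lemma side_of_ne {c d : Bool} (h : c ≠ d) : side d = -side c := by
  cases c <;> cases d <;> simp_all [side]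

/-- The height of a port. -/
def portHeight (j : Fin 3) : ℝ := 4 * (j : ℝ) - 4

/-- The height of a middle vertex of a path from the apex to a port. -/
def midHeight (j : Fin 3) (i : Fin ℓ) : ℝ := portHeight j + 1 + (i : ℝ) / ℓ

lemma portHeight_cases (j : Fin 3) : j = 0 ∧ portHeight j = -4 ∨ j = 1 ∧ portHeight j = 0 ∨
    j = 2 ∧ portHeight j = 4 := by
  fin_cases j <;> simp [portHeight]
  norm_num

lemma portHeight_injective : Function.Injective portHeight := by
  intro j j' h
  have : (j : ℝ) = j' := by unfold portHeight at h; linarith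
  exact Fin.ext (by exact_mod_cast this)

lemma midHeight_bounds (j : Fin 3) (i : Fin ℓ) :
    portHeight j + 1 ≤ midHeight j i ∧ midHeight j i < portHeight j + 2 := by
  have hi : (i : ℝ) < ℓ := by exact_mod_cast i.2
  have h₀ : (0 : ℝ) ≤ i := by positivity
  have h₁ : (i : ℝ) / ℓ < 1 := (div_lt_one (h₀.trans_lt hi)).mpr hi
  have h₂ : 0 ≤ (i : ℝ) / ℓ := by positivity
  unfold midHeight
  constructor <;> linarith

lemma midHeight_inj {j j' : Fin 3} {i i' : Fin ℓ} (h : midHeight j i = midHeight j' i') :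
    j = j' ∧ i = i' := by
  have hj : j = j' := by
    have h₁ := midHeight_bounds j i
    have h₂ := midHeight_bounds j' i'
    rcases portHeight_cases j with ⟨rfl, e⟩ | ⟨rfl, e⟩ | ⟨rfl, e⟩ <;>
    rcases portHeight_cases j' with ⟨rfl, e'⟩ | ⟨rfl, e'⟩ | ⟨rfl, e'⟩ <;>
    first | rfl | (exfalso; linarith [h₁.1, h₁.2, h₂.1, h₂.2])
  subst hj
  have hl : (ℓ : ℝ) ≠ 0 := by
    have := i.pos
    positivity
  have h' : (i : ℝ) / ℓ = i' / ℓ := by unfold midHeight at h; linarith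
  rw [div_left_inj' hl] at h'
  exact ⟨rfl, Fin.ext (by exact_mod_cast h')⟩

/-- The positions of the vertices; `x` is the distance of the second hub from the axis. -/
def pos (x : ℝ) : Vtx ℓ m → ℝ × ℝ
  | apex => (0, 0)
  | iso k => (0, k + 1)
  | mid c j i => (side c * 2, midHeight j i)
  | port c j => (side c * 3, portHeight j)
  | hub c true => (side c * 4, 1)
  | hub c false => (side c * x, 0)

/-- The equations of the edges of one copy, in coordinates where the copy is drawn on the
positive side. -/
inductive OnEdge (x : ℝ) (c : Bool) (X Y : ℝ) : Vtx ℓ m → Vtx ℓ m → Prop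
  | apexMid (j i) : 0 ≤ X → X ≤ 2 → 2 * Y = X * midHeight j i → OnEdge x c X Y apex (mid c j i)
  | midPort (j i) : 2 ≤ X → X ≤ 3 →
      Y = portHeight j + (3 - X) * (midHeight j i - portHeight j) →
      OnEdge x c X Y (mid c j i) (port c j)
  | hubTrue (j) : 3 ≤ X → X ≤ 4 → Y = portHeight j + (X - 3) * (1 - portHeight j) →
      OnEdge x c X Y (port c j) (hub c true)
  | hubFalse (j) : (3 ≤ X ∧ X ≤ x ∨ x ≤ X ∧ X ≤ 3) → (x - 3) * Y = portHeight j * (x - X) →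
      OnEdge x c X Y (port c j) (hub c false)

lemma exists_onEdge {x : ℝ} {u v : Vtx ℓ m} (h : Arrow u v) {p : ℝ × ℝ}
    (hp : p ∈ segment ℝ (pos x u) (pos x v)) : ∃ c, OnEdge x c (side c * p.1) p.2 u v := by
  rw [segment_eq_image_lineMap] at hp
  obtain ⟨t, ⟨h₀, h₁⟩, rfl⟩ := hp
  have key : ∀ c (a b : ℝ), side c * (side c * a + t * (side c * b - side c * a)) =
      a + t * (b - a) := fun c a b => by linear_combination (a + t * (b - a)) * side_mul_self c
  have key₀ : ∀ c (b : ℝ), side c * (0 + t * (side c * b - 0)) = t * b :=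
    fun c b => by linear_combination t * b * side_mul_self c
  have fst : ∀ a b : ℝ × ℝ, (AffineMap.lineMap a b t : ℝ × ℝ).1 = a.1 + t * (b.1 - a.1) := by
    intro a b
    simp [AffineMap.lineMap_apply, add_comm]
  have snd : ∀ a b : ℝ × ℝ, (AffineMap.lineMap a b t : ℝ × ℝ).2 = a.2 + t * (b.2 - a.2) := by
    intro a b
    simp [AffineMap.lineMap_apply, add_comm]
  cases h with
  | apexMid c j i =>
    refine ⟨c, .apexMid j i ?_ ?_ ?_⟩ <;> simp only [pos, fst, snd, key₀] <;>
      linarith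
  | midPort c j i =>
    refine ⟨c, .midPort j i ?_ ?_ ?_⟩ <;> simp only [pos, fst, snd, key] <;>
      linarith
  | portHub c j k =>
    cases k with
    | true =>
      refine ⟨c, .hubTrue j ?_ ?_ ?_⟩ <;> simp only [pos, fst, snd, key] <;>
        linarith
    | false =>
      refine ⟨c, .hubFalse j ?_ ?_⟩ <;> simp only [pos, fst, snd, key]
      · rcases le_total 3 x with hx | hx
        · left
          constructor <;> nlinarith
        · right
          constructor <;> nlinarith
      · ring

lemma OnEdge.nonneg {x : ℝ} (hx : 0 < x) {c : Bool} {X Y : ℝ} {u v : Vtx ℓ m}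
    (h : OnEdge x c X Y u v) : 0 < X ∨ X = 0 ∧ Y = 0 := by
  cases h with
  | apexMid j i h₁ h₂ h₃ =>
    rcases h₁.eq_or_lt with rfl | h
    · right
      constructor <;> linarith
    · exact .inl h
  | midPort => left; linarith
  | hubTrue => left; linarith
  | hubFalse j h =>
    left
    rcases h with h | h <;> linarith [h.1, h.2]

lemma OnEdge.eq_copy {x : ℝ} (hx : 0 < x) {c d : Bool} {p : ℝ × ℝ} {u v w z : Vtx ℓ m}
    (h : OnEdge x c (side c * p.1) p.2 u v) (h' : OnEdge x d (side d * p.1) p.2 w z)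
    (hp : p ≠ (0, 0)) : c = d := by
  by_contra hcd
  have e := side_of_ne hcd
  have h₀ : side c * p.1 = 0 → p.1 = 0 := by
    intro h
    linear_combination side c * h - p.1 * side_mul_self c
  rw [e] at h'
  have := h.nonneg hx
  have := h'.nonneg hx
  apply hp
  ext
  · apply h₀
    grind
  · grind

lemma pos_eq {c : Bool} {p : ℝ × ℝ} {a b : ℝ} (h : side c * p.1 = a) (h' : p.2 = b) :
    (side c * a, b) = p := by
  ext
  · subst h
    linear_combination p.1 * side_mul_self c
  · exact h'.symm

/-- The position of a vertex among the possible ends of arrows. -/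
def kind : Vtx ℓ m → ℕ
  | mid _ _ _ => 0
  | port _ _ => 1
  | hub _ true => 2
  | hub _ false => 3
  | _ => 4

lemma OnEdge.meet {x : ℝ} (hx : x = 1 ∨ x = 5) {c : Bool} {X Y : ℝ} {u v w z : Vtx ℓ m}
    (h : OnEdge x c X Y u v) (h' : OnEdge x c X Y w z) (hne : s(u, v) ≠ s(w, z))
    (hk : kind v ≤ kind z) : (∃ a : Vtx ℓ m, pos x a = (side c * X, Y)) ∨
      (x = 1 ∧ u = apex ∧ w ≠ apex ∧ z ≠ apex) ∨
      (x = 5 ∧ v = hub c true ∧ z = hub c false ∧ X = 19 / 5 ∧ Y = 0) := by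
  have port_vertex : ∀ j, X = 3 → Y = portHeight j →
      ∃ a : Vtx ℓ m, pos x a = (side c * X, Y) := fun j h₁ h₂ => ⟨port c j, by rw [h₁, h₂]; rfl⟩
  cases h with
  | apexMid j i a₁ a₂ a₃ =>
    cases h' with
    | apexMid j' i' b₁ b₂ b₃ =>
      rcases b₁.eq_or_lt with rfl | hX
      · left
        refine ⟨apex, ?_⟩
        rw [show Y = 0 by linarith, mul_zero]
        rfl
      · have : midHeight j i = midHeight j' i' := mul_left_cancel₀ hX.ne' (by linarith)
        obtain ⟨rfl, rfl⟩ := midHeight_inj this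
        exact absurd rfl hne
    | midPort j' i' b₁ b₂ b₃ =>
      left
      obtain rfl : X = 2 := by linarith
      refine ⟨mid c j i, ?_⟩
      rw [show Y = midHeight j i by linarith]
      rfl
    | hubTrue j' b₁ b₂ b₃ => linarith
    | hubFalse j' b₁ b₂ =>
      rcases hx with rfl | rfl
      · exact .inr (.inl ⟨rfl, rfl, by simp, by simp⟩)
      · rcases b₁ with b₁ | b₁ <;> linarith [b₁.1, b₁.2]
  | midPort j i a₁ a₂ a₃ =>
    cases h' with
    | apexMid => simp [kind] at hk
    | midPort j' i' b₁ b₂ b₃ =>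
      left
      rcases a₂.eq_or_lt with hX | hX
      · exact port_vertex j hX (by rw [a₃, hX]; ring)
      exfalso
      have k := midHeight_bounds j i
      have k' := midHeight_bounds j' i'
      have hX' : 0 < 3 - X := by linarith
      have m₁ := mul_lt_mul_of_pos_left k.2 hX'
      have m₂ := mul_le_mul_of_nonneg_left k.1 hX'.le
      have m₁' := mul_lt_mul_of_pos_left k'.2 hX'
      have m₂' := mul_le_mul_of_nonneg_left k'.1 hX'.le
      by_cases hj : j = j'
      · subst hj
        have : midHeight j i = midHeight j i' := mul_left_cancel₀ hX'.ne' (by linarith)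
        obtain ⟨-, rfl⟩ := midHeight_inj this
        exact absurd rfl hne
      · rcases portHeight_cases j with ⟨rfl, e⟩ | ⟨rfl, e⟩ | ⟨rfl, e⟩ <;>
        rcases portHeight_cases j' with ⟨rfl, e'⟩ | ⟨rfl, e'⟩ | ⟨rfl, e'⟩ <;>
        first | exact hj rfl | (rw [e] at a₃ m₁ m₂; rw [e'] at b₃ m₁' m₂'; linarith)
    | hubTrue j' b₁ b₂ b₃ =>
      obtain rfl : X = 3 := by linarith
      exact .inl (port_vertex j rfl (by linarith))
    | hubFalse j' b₁ b₂ =>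
      left
      rcases a₂.eq_or_lt with hX | hX
      · exact port_vertex j hX (by rw [a₃, hX]; ring)
      exfalso
      rcases hx with rfl | rfl
      · have k := midHeight_bounds j i
        have hX' : 0 < 3 - X := by linarith
        have m₁ := mul_lt_mul_of_pos_left k.2 hX'
        have m₂ := mul_le_mul_of_nonneg_left k.1 hX'.le
        rcases portHeight_cases j with ⟨rfl, e⟩ | ⟨rfl, e⟩ | ⟨rfl, e⟩ <;>
        rcases portHeight_cases j' with ⟨rfl, e'⟩ | ⟨rfl, e'⟩ | ⟨rfl, e'⟩ <;>
        (rw [e] at a₃ m₁ m₂; rw [e'] at b₂; linarith)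
      · rcases b₁ with b₁ | b₁ <;> linarith [b₁.1, b₁.2]
  | hubTrue j a₁ a₂ a₃ =>
    cases h' with
    | apexMid => simp [kind] at hk
    | midPort => simp [kind] at hk
    | hubTrue j' b₁ b₂ b₃ =>
      left
      rcases a₂.eq_or_lt with rfl | hX
      · refine ⟨hub c true, ?_⟩
        rw [show Y = 1 by linarith]
        rfl
      · have : portHeight j = portHeight j' :=
          mul_left_cancel₀ (sub_pos.mpr hX).ne' (by linarith)
        rw [portHeight_injective this] at hne
        exact absurd rfl hne
    | hubFalse j' b₁ b₂ =>
      rcases hx with rfl | rfl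
      · obtain rfl : X = 3 := by rcases b₁ with b₁ | b₁ <;> linarith [b₁.1, b₁.2]
        exact .inl (port_vertex j rfl (by linarith))
      · rcases a₁.eq_or_lt with rfl | hX
        · exact .inl (port_vertex j rfl (by linarith))
        refine .inr (.inr ⟨rfl, rfl, rfl, ?_⟩)
        rcases portHeight_cases j with ⟨rfl, e⟩ | ⟨rfl, e⟩ | ⟨rfl, e⟩ <;>
        rcases portHeight_cases j' with ⟨rfl, e'⟩ | ⟨rfl, e'⟩ | ⟨rfl, e'⟩ <;>
        (rw [e] at a₃; rw [e'] at b₂; constructor <;> linarith)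
  | hubFalse j a₁ a₂ =>
    cases h' with
    | apexMid => simp [kind] at hk
    | midPort => simp [kind] at hk
    | hubTrue => simp [kind] at hk
    | hubFalse j' b₁ b₂ =>
      left
      by_cases hX : X = x
      · subst hX
        refine ⟨hub c false, ?_⟩
        rw [show Y = 0 by rcases hx with rfl | rfl <;> linarith]
        rfl
      · have : portHeight j = portHeight j' :=
          mul_right_cancel₀ (sub_ne_zero.mpr (Ne.symm hX)) (a₂.symm.trans b₂)
        rw [portHeight_injective this] at hne
        exact absurd rfl hne

lemma pos_injective {x : ℝ} (hx : x = 1 ∨ x = 5) :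
    Function.Injective (pos x : Vtx ℓ m → ℝ × ℝ) := by
  have hs : ∀ c d (a b : ℝ), 0 < a → 0 < b → side c * a = side d * b → c = d ∧ a = b := by
    intro c d a b ha hb h
    cases c <;> cases d <;> simp only [side] at h <;> grind
  have hs₀ : ∀ c (a : ℝ), 0 < a → side c * a ≠ 0 := by
    intro c a ha h
    cases c <;> simp only [side] at h <;> grind
  have hs₀' : ∀ c (a : ℝ), 0 < a → 0 ≠ side c * a := fun c a ha => (hs₀ c a ha).symm
  have hx' : 0 < x := by rcases hx with rfl | rfl <;> norm_num
  have two : (0 : ℝ) < 2 := by norm_num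
  have three : (0 : ℝ) < 3 := by norm_num
  have four : (0 : ℝ) < 4 := by norm_num
  have hk : ∀ k : Fin m, (0 : ℝ) < k + 1 := fun k => by positivity
  have four_ne : (4 : ℝ) ≠ x := by rcases hx with rfl | rfl <;> norm_num
  have three_ne : (3 : ℝ) ≠ x := by rcases hx with rfl | rfl <;> norm_num
  have two_ne : (2 : ℝ) ≠ x := by rcases hx with rfl | rfl <;> norm_num
  rintro (_ | k | ⟨c, j, i⟩ | ⟨c, j⟩ | ⟨c, _ | _⟩) (_ | k' | ⟨d, j', i'⟩ | ⟨d, j'⟩ | ⟨d, _ | _⟩) h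
  all_goals
    simp only [pos, Prod.mk.injEq] at h
    obtain ⟨h₁, h₂⟩ := h
    first
    | rfl
    | exact absurd h₁ (hs₀ _ _ (by assumption))
    | exact absurd h₁ (hs₀' _ _ (by assumption))
    | exact absurd h₂ (hk _).ne'
    | exact absurd h₂ (hk _).ne
    | (have h₃ := hs _ _ _ _ (by assumption) (by assumption) h₁
       obtain ⟨rfl, h₃⟩ := h₃
       first
       | rfl
       | exact congrArg _ (portHeight_injective h₂)
       | (obtain ⟨rfl, rfl⟩ := midHeight_inj h₂; rfl)
       | (norm_num at h₃; done)
       | exact absurd h₃ (by assumption)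
       | exact absurd h₃.symm (by assumption))
    | (have : k = k' := Fin.ext (by exact_mod_cast add_right_cancel h₂)
       rw [this])

lemma OnEdge.eq_or_eq {x : ℝ} (hx : x = 1 ∨ x = 5) {c : Bool} {u v w : Vtx ℓ m}
    (h : OnEdge x c (side c * (pos x w).1) (pos x w).2 u v) : w = u ∨ w = v := by
  have hx' : 0 < x := by rcases hx with rfl | rfl <;> norm_num
  have self : ∀ d (a : ℝ), 0 < a → 0 ≤ side c * (side d * a) →
      c = d ∧ side c * (side d * a) = a := by
    intro d a ha h
    cases c <;> cases d <;> simp only [side] at h ⊢ <;> grind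
  have hX : 0 ≤ side c * (pos x w).1 := by
    rcases h.nonneg hx' with h | h
    · exact h.le
    · exact h.1.ge
  generalize hX' : side c * (pos x w).1 = X at h
  generalize hY : (pos x w).2 = Y at h
  have hw : (w = apex ∧ X = 0 ∧ Y = 0) ∨ (∃ k, w = iso k ∧ X = 0 ∧ 0 < Y) ∨
      (∃ j i, w = mid c j i ∧ X = 2 ∧ Y = midHeight j i) ∨
      (∃ j, w = port c j ∧ X = 3 ∧ Y = portHeight j) ∨
      (w = hub c true ∧ X = 4 ∧ Y = 1) ∨ (w = hub c false ∧ X = x ∧ Y = 0) := by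
    subst hX' hY
    rcases w with _ | k | ⟨d, j, i⟩ | ⟨d, j⟩ | ⟨d, _ | _⟩
    · simp [pos]
    · right; left
      refine ⟨k, rfl, by simp [pos], ?_⟩
      simp only [pos]
      positivity
    all_goals
      obtain ⟨rfl, e⟩ := self d _ (by first | assumption | norm_num) hX
      simp [pos, e]
  clear hX' hY self hX
  cases h with
  | apexMid j i h₁ h₂ h₃ =>
    have k := midHeight_bounds j i
    rcases hw with ⟨rfl, -⟩ | ⟨_, rfl, hX, hY⟩ | ⟨j', i', rfl, hX, hY⟩ | ⟨_, rfl, hX, -⟩ |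
      ⟨rfl, hX, -⟩ | ⟨rfl, hX, hY⟩
    · exact .inl rfl
    · rw [hX] at h₃
      linarith
    · obtain ⟨rfl, rfl⟩ := midHeight_inj (show midHeight j i = midHeight j' i' by
        rw [hX] at h₃
        linarith)
      exact .inr rfl
    · linarith
    · linarith
    · rcases hx with rfl | rfl
      · rw [hX] at h₃
        rcases portHeight_cases j with ⟨rfl, e⟩ | ⟨rfl, e⟩ | ⟨rfl, e⟩ <;> linarith
      · linarith
  | midPort j i h₁ h₂ h₃ =>
    rcases hw with ⟨-, hX, -⟩ | ⟨_, -, hX, -⟩ | ⟨j', i', rfl, hX, hY⟩ | ⟨j', rfl, hX, hY⟩ |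
      ⟨rfl, hX, -⟩ | ⟨rfl, hX, hY⟩
    · linarith
    · linarith
    · obtain ⟨rfl, rfl⟩ := midHeight_inj (show midHeight j i = midHeight j' i' by
        rw [hX] at h₃
        linarith)
      exact .inl rfl
    · right
      rw [portHeight_injective (show portHeight j' = portHeight j by
        rw [hX] at h₃
        linarith)]
    · linarith
    · rcases hx with rfl | rfl <;> linarith
  | hubTrue j h₁ h₂ h₃ =>
    rcases hw with ⟨-, hX, -⟩ | ⟨_, -, hX, -⟩ | ⟨j', i', -, hX, -⟩ | ⟨j', rfl, hX, hY⟩ |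
      ⟨rfl, hX, -⟩ | ⟨rfl, hX, hY⟩
    · linarith
    · linarith
    · linarith
    · left
      rw [portHeight_injective (show portHeight j' = portHeight j by
        rw [hX] at h₃
        linarith)]
    · exact .inr rfl
    · rcases hx with rfl | rfl <;> linarith
  | hubFalse j h₁ h₂ =>
    have hj := portHeight_cases j
    rcases hw with ⟨-, hX, -⟩ | ⟨_, -, hX, -⟩ | ⟨j', i', rfl, hX, hY⟩ | ⟨j', rfl, hX, hY⟩ |
      ⟨rfl, hX, hY⟩ | ⟨rfl, -⟩
    · rcases h₁ with h | h <;> linarith [h.1, h.2]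
    · rcases h₁ with h | h <;> linarith [h.1, h.2]
    · rcases hx with rfl | rfl
      · have k := midHeight_bounds j' i'
        rw [← hY, hX] at *
        rcases hj with ⟨-, e⟩ | ⟨-, e⟩ | ⟨-, e⟩ <;>
        rcases portHeight_cases j' with ⟨-, e'⟩ | ⟨-, e'⟩ | ⟨-, e'⟩ <;>
        (rw [e] at h₂; linarith)
      · rcases h₁ with h | h <;> linarith [h.1, h.2]
    · left
      rw [portHeight_injective (show portHeight j' = portHeight j by
        rw [hX] at h₂
        rcases hx with rfl | rfl <;> linarith)]
    · rw [hX, hY] at h₂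
      rcases hx with rfl | rfl
      · rcases h₁ with h | h <;> linarith [h.1, h.2]
      · rcases hj with ⟨-, e⟩ | ⟨-, e⟩ | ⟨-, e⟩ <;> linarith
    · exact .inr rfl

lemma avoids {x : ℝ} (hx : x = 1 ∨ x = 5) {u v w : Vtx ℓ m} (h : (graph ℓ m).Adj u v)
    (hw : pos x w ∈ segment ℝ (pos x u) (pos x v)) : w = u ∨ w = v := by
  rcases graph_adj.mp h with h | h
  · obtain ⟨c, hc⟩ := exists_onEdge h hw
    exact hc.eq_or_eq hx
  · rw [segment_symm] at hw
    obtain ⟨c, hc⟩ := exists_onEdge h hw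
    exact (hc.eq_or_eq hx).symm

/-- How two edges can cross in the drawing given by `pos x`. -/
inductive CrossKind (x : ℝ) (p : ℝ × ℝ) : Vtx ℓ m → Vtx ℓ m → Vtx ℓ m → Vtx ℓ m → Prop
  | near (v w z) : x = 1 → apex ≠ v → w ≠ apex → z ≠ apex → CrossKind x p apex v w z
  | far (c u w) : x = 5 → p = (side c * (19 / 5), 0) → (∀ d, u ≠ hub d true) →
      (∀ d, w ≠ hub d true) → CrossKind x p u (hub c true) w (hub c false)

lemma crossKind_of_arrow {x : ℝ} (hx : x = 1 ∨ x = 5) {u v w z : Vtx ℓ m} {p : ℝ × ℝ}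
    (h : Arrow u v) (h' : Arrow w z) (hne : s(u, v) ≠ s(w, z))
    (hp : p ∈ segment ℝ (pos x u) (pos x v)) (hp' : p ∈ segment ℝ (pos x w) (pos x z))
    (hr : p ∉ Set.range (pos x : Vtx ℓ m → ℝ × ℝ)) :
    CrossKind x p u v w z ∨ CrossKind x p w z u v := by
  have hx' : 0 < x := by rcases hx with rfl | rfl <;> norm_num
  wlog hk : kind v ≤ kind z generalizing u v w z
  · exact (this h' h hne.symm hp' hp (le_of_not_ge hk)).symm
  left
  obtain ⟨c, hc⟩ := exists_onEdge h hp
  obtain ⟨d, hd⟩ := exists_onEdge h' hp'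
  obtain rfl := hc.eq_copy hx' hd (fun e => hr ⟨apex, e.symm⟩)
  have arrow_ne : ∀ {u v : Vtx ℓ m}, Arrow u v → ∀ d, u ≠ hub d true := by
    intro u v h d
    cases h <;> simp
  rcases hc.meet hx hd hne hk with ⟨a, ha⟩ | ⟨h₁, rfl, hw, hz⟩ | ⟨h₁, rfl, rfl, hX, hY⟩
  · exact absurd ⟨a, ha.trans (pos_eq rfl rfl)⟩ hr
  · refine .near _ _ _ h₁ ?_ hw hz
    rintro rfl
    cases h
  · exact .far _ _ _ h₁ (pos_eq hX hY).symm (arrow_ne h) (arrow_ne h')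

lemma crossKind_of_adj {x : ℝ} (hx : x = 1 ∨ x = 5) {u v w z : Vtx ℓ m} {p : ℝ × ℝ}
    (h : (graph ℓ m).Adj u v) (h' : (graph ℓ m).Adj w z) (hne : s(u, v) ≠ s(w, z))
    (hp : p ∈ segment ℝ (pos x u) (pos x v)) (hp' : p ∈ segment ℝ (pos x w) (pos x z))
    (hr : p ∉ Set.range (pos x : Vtx ℓ m → ℝ × ℝ)) :
    ∃ u' v' w' z' : Vtx ℓ m, (u' = u ∧ v' = v ∨ u' = v ∧ v' = u) ∧
      (w' = w ∧ z' = z ∨ w' = z ∧ z' = w) ∧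
      (CrossKind x p u' v' w' z' ∨ CrossKind x p w' z' u' v') := by
  wlog huv : Arrow u v generalizing u v
  · obtain ⟨u', v', w', z', h₁, h₂⟩ := this h.symm (by rwa [Sym2.eq_swap])
      (by rwa [segment_symm]) ((graph_adj.mp h).resolve_left huv)
    exact ⟨u', v', w', z', h₁.symm, h₂⟩
  wlog hwz : Arrow w z generalizing w z
  · obtain ⟨u', v', w', z', h₁, h₂, h₃⟩ := this h'.symm (by rwa [segment_symm])
      (by rwa [Sym2.eq_swap (a := z)]) ((graph_adj.mp h').resolve_left hwz)
    exact ⟨u', v', w', z', h₁, h₂.symm, h₃⟩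
  exact ⟨u, v, w, z, .inl ⟨rfl, rfl⟩, .inl ⟨rfl, rfl⟩,
    crossKind_of_arrow hx huv hwz hne hp hp' hr⟩

lemma isStraightLayout {x : ℝ} (hx : x = 1 ∨ x = 5) {T : Set (Vtx ℓ m)}
    (hT : ∀ p u v w z, CrossKind x p u v w z → ((u ∈ T ∨ v ∈ T) ↔ ¬ (w ∈ T ∨ z ∈ T))) :
    IsStraightLayout (graph ℓ m) (pos x) T where
  inj := pos_injective hx
  avoids _ _ _ := avoids hx
  bipartite u v w z p huv hwz hne hp hp' hr := by
    obtain ⟨u', v', w', z', h₁, h₂, h₃⟩ := crossKind_of_adj hx huv hwz hne hp hp' hr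
    have h₁' : (u' ∈ T ∨ v' ∈ T) ↔ (u ∈ T ∨ v ∈ T) := by
      rcases h₁ with ⟨rfl, rfl⟩ | ⟨rfl, rfl⟩
      · rfl
      · exact or_comm
    have h₂' : (w' ∈ T ∨ z' ∈ T) ↔ (w ∈ T ∨ z ∈ T) := by
      rcases h₂ with ⟨rfl, rfl⟩ | ⟨rfl, rfl⟩
      · rfl
      · exact or_comm
    rw [← h₁', ← h₂']
    rcases h₃ with h | h
    · exact hT _ _ _ _ _ h
    · have := hT _ _ _ _ _ h
      exact iff_not_comm.mp this

lemma isStraightLayout_near : IsStraightLayout (graph ℓ m) (pos 1) {apex} := by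
  refine isStraightLayout (.inl rfl) fun p u v w z h => ?_
  cases h with
  | near v w z _ hv hw hz => simp [hw, hz]
  | far _ _ _ h => norm_num at h

lemma isStraightLayout_far :
    IsStraightLayout (graph ℓ m) (pos 5) (Set.range fun c => hub c true) := by
  refine isStraightLayout (.inr rfl) fun p u v w z h => ?_
  cases h with
  | near v w z h => norm_num at h
  | far c u w _ _ hu hw => simp [hw]

end Vtx

/-- For every `ℓ ≥ 3` there exists a 1-apex simple graph on
exactly `n = 11ℓ - 4` vertices with `cr_{1-apex}(G) ≥ ℓ` and `cr(G) ≤ 3`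
(hence the 1-apex crossing ratio is `Ω(n)`). -/
theorem one_apex_crossing_ratio_lower (ℓ : ℕ) (hℓ : 3 ≤ ℓ) :
    ∃ G : SimpleGraph (Fin (11 * ℓ - 4)),
      (∃ Γ : Drawing G, Γ.IsKApex 1) ∧
      ℓ ≤ crNumRestricted G (fun Γ => Γ.IsKApex 1) ∧
      crNum G ≤ 3 := by
  obtain ⟨e⟩ : Nonempty (Fin (11 * ℓ - 4) ≃ Vtx ℓ (5 * ℓ - 15)) := by
    have := Vtx.nonempty_equiv_fin ℓ (5 * ℓ - 15)
    rwa [show 6 * ℓ + 11 + (5 * ℓ - 15) = 11 * ℓ - 4 by omega] at this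
  have apex : ∃ Γ : Drawing ((Vtx.graph ℓ (5 * ℓ - 15)).comap e), Γ.IsKApex 1 := by
    have h := (Vtx.isStraightLayout_near (ℓ := ℓ) (m := 5 * ℓ - 15)).comap e
    have hs : e ⁻¹' {Vtx.apex} = {e.symm Vtx.apex} := by
      ext
      simp [Equiv.eq_symm_apply]
    rw [hs] at h
    exact ⟨_, h.isKApex_one⟩
  refine ⟨(Vtx.graph ℓ (5 * ℓ - 15)).comap e, apex, ?_, ?_⟩
  · obtain ⟨Γ, hΓ⟩ := apex
    refine le_csInf ⟨_, Γ, hΓ, rfl⟩ ?_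
    rintro _ ⟨Γ', hΓ', rfl⟩
    refine Γ'.le_crossings_of_isKApex_one e.symm.injective (fun u v huv => ?_) hΓ'
    simpa using Vtx.graph_adj.mpr (.inl huv)
  · have h := (Vtx.isStraightLayout_far (ℓ := ℓ) (m := 5 * ℓ - 15)).comap e
    refine le_trans (b := h.drawing.crossings) (Nat.sInf_le ⟨h.drawing, rfl⟩) ?_
    have hsub : h.drawing.crossingSet ⊆ {((19 / 5 : ℝ), (0 : ℝ)), (-(19 / 5), 0)} := by
      rintro p ⟨f, g, hc⟩
      obtain ⟨u, v, w, z, rfl, rfl, huv, hwz, hne, hp, hp', hr⟩ := h.exists_of_crossing hc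
      have hne' : s(e u, e v) ≠ s(e w, e z) := by simpa [Sym2.eq_iff] using hne
      rw [e.surjective.range_comp] at hr
      obtain ⟨_, _, _, _, -, -, hk⟩ := Vtx.crossKind_of_adj (.inr rfl) huv hwz hne' hp hp' hr
      have : ∃ c, p = (Vtx.side c * (19 / 5), 0) := by
        rcases hk with hk | hk <;> cases hk with
        | near _ _ _ h => norm_num at h
        | far c _ _ _ h => exact ⟨c, h⟩
      obtain ⟨c, rfl⟩ := this
      cases c <;> simp [Vtx.side]
    calc h.drawing.crossings
        ≤ ({((19 / 5 : ℝ), (0 : ℝ)), (-(19 / 5), 0)} : Set (ℝ × ℝ)).ncard :=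
          Set.ncard_le_ncard hsub
      _ ≤ 1 + 1 := (Set.ncard_insert_le _ _).trans (by rw [Set.ncard_singleton])
      _ ≤ 3 := by norm_num
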